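/- Let P be a graded poset of rank r and κ > 0. Then ∇ ∘ Row^B_F = Row^B_A ∘ ∇ and ∇ ∘ Rvac^B_F = Rvac^B_A ∘ ∇ as maps F^B_κ(P) → A^B_κ(P). Consequently Rvac^B_A is an involution on A^B_κ(P) and Rvac^B_A ∘ Row^B_A = (Row^B_A)^{−1} ∘ Rvac^B_A. -/

import Mathlib

open scoped Classical

noncomputable section

/-- `P̂`: the poset `P` with a new minimum `0̂` and a new maximum `1̂` adjoined. -/
abbrev Phat (P : Type) := WithBot (WithTop P)

instance {P : Type} [Fintype P] : Fintype (Phat P) :=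
  inferInstanceAs (Fintype (Option (Option P)))

/-- The inclusion of `P` into `P̂`. -/
def emb {P : Type} (p : P) : Phat P := ((p : WithTop P) : WithBot (WithTop P))

/-- The new maximum `1̂` of `P̂`. -/
def topHat (P : Type) : Phat P := ((⊤ : WithTop P) : WithBot (WithTop P))

variable {P : Type} [Fintype P] [PartialOrder P]

/-- `∑_{y ⋖ x} π(y)`. -/
def covSumBelow (π : Phat P → ℝ) (x : Phat P) : ℝ :=
  ∑ y : Phat P, if y ⋖ x then π y else 0

/-- `∑_{x ⋖ y} 1/π(y)`. -/
def covSumAboveInv (π : Phat P → ℝ) (x : Phat P) : ℝ :=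
  ∑ y : Phat P, if x ⋖ y then (π y)⁻¹ else 0

/-- The birational order-filter rank toggle `𝐭_i`, in simultaneous form (it agrees with the
composition of the pairwise commuting birational order filter toggles `t_p` over `p ∈ P_i`,
since a toggle `t_p` only changes the value at `p` and only reads values at `p` and at
elements covering or covered by `p`, which have different ranks). -/
def rankToggleB (rk : P → ℕ) (i : ℕ) (π : Phat P → ℝ) : Phat P → ℝ :=
  fun x =>
    if ∃ p : P, rk p = i ∧ x = emb p then
      covSumBelow π x / (π x * covSumAboveInv π x)
    else π x

/-- Apply a word of rank toggles; the head of the list is applied last, matching the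
convention that in a product `𝐭_{i_1} 𝐭_{i_2} ⋯ 𝐭_{i_k}` the rightmost factor acts first. -/
def applyB (rk : P → ℕ) : List ℕ → (Phat P → ℝ) → Phat P → ℝ
  | [] => fun π => π
  | i :: w => fun π => rankToggleB rk i (applyB rk w π)

/-- The word `𝐭_0 𝐭_1 ⋯ 𝐭_r` for rowmotion. -/
def rowWordB (r : ℕ) : List ℕ := List.range (r + 1)

/-- The word `(𝐭_r)(𝐭_{r-1} 𝐭_r) ⋯ (𝐭_0 𝐭_1 ⋯ 𝐭_r)` for rowvacuation. -/
def rvacWordB (r : ℕ) : List ℕ :=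
  (List.range (r + 1)).foldr (fun k acc => (List.range (r + 1)).drop (r - k) ++ acc) []

/-- The word `(𝐭_0)(𝐭_1 𝐭_0) ⋯ (𝐭_r 𝐭_{r-1} ⋯ 𝐭_0)` for dual rowvacuation. -/
def drvacWordB (r : ℕ) : List ℕ :=
  (List.range (r + 1)).foldr (fun k acc => (List.range (k + 1)).reverse ++ acc) []

/-- Birational order filter rowmotion `Row^B_F = 𝐭_0 𝐭_1 ⋯ 𝐭_r`. -/
def RowB (rk : P → ℕ) (r : ℕ) : (Phat P → ℝ) → Phat P → ℝ := applyB rk (rowWordB r)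

/-- The inverse of birational order filter rowmotion, `(Row^B_F)⁻¹ = 𝐭_r ⋯ 𝐭_1 𝐭_0`
(each toggle is an involution, so the reversed word gives the inverse map). -/
def RowInvB (rk : P → ℕ) (r : ℕ) : (Phat P → ℝ) → Phat P → ℝ := applyB rk (rowWordB r).reverse

/-- Birational order filter rowvacuation `Rvac^B_F`. -/
def RvacB (rk : P → ℕ) (r : ℕ) : (Phat P → ℝ) → Phat P → ℝ := applyB rk (rvacWordB r)

/-- Birational order filter dual rowvacuation `DRvac^B_F`. -/
def DRvacB (rk : P → ℕ) (r : ℕ) : (Phat P → ℝ) → Phat P → ℝ := applyB rk (drvacWordB r)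

end

noncomputable section

variable {P : Type} [Fintype P] [PartialOrder P]

/-- The sum, over all maximal chains `C` of `P` containing `p`, of `∏_{y ∈ C} π(y)`. -/
def chainSum (π : P → ℝ) (p : P) : ℝ :=
  ∑ C ∈ Finset.univ.filter
      (fun C : Finset P => IsMaxChain (· ≤ ·) (C : Set P) ∧ p ∈ C),
    ∏ y ∈ C, π y

/-- The birational antichain rank toggle `𝛕_i`, in simultaneous form (it agrees with the
composition of the pairwise commuting birational antichain toggles `τ_p` over `p ∈ P_i`,
since in a graded poset no maximal chain contains two distinct elements of the same rank). -/
def arankToggleB (κ : ℝ) (rk : P → ℕ) (i : ℕ) (π : P → ℝ) : P → ℝ :=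
  fun x => if rk x = i then κ / chainSum π x else π x

/-- Apply a word of antichain rank toggles; the head of the list is applied last. -/
def aApplyB (κ : ℝ) (rk : P → ℕ) : List ℕ → (P → ℝ) → P → ℝ
  | [] => fun π => π
  | i :: w => fun π => arankToggleB κ rk i (aApplyB κ rk w π)

/-- The word `𝛕_r 𝛕_{r-1} ⋯ 𝛕_0` for antichain rowmotion. -/
def arowWordB (r : ℕ) : List ℕ := (List.range (r + 1)).reverse

/-- The word `(𝛕_r)(𝛕_r 𝛕_{r-1}) ⋯ (𝛕_r 𝛕_{r-1} ⋯ 𝛕_1 𝛕_0)` for antichain rowvacuation. -/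
def arvacWordB (r : ℕ) : List ℕ :=
  (List.range (r + 1)).foldr
    (fun k acc => (List.range (r + 1)).reverse.take (k + 1) ++ acc) []

/-- Birational antichain rowmotion `Row^B_A = 𝛕_r 𝛕_{r-1} ⋯ 𝛕_0`. -/
def RowAB (κ : ℝ) (rk : P → ℕ) (r : ℕ) : (P → ℝ) → P → ℝ := aApplyB κ rk (arowWordB r)

/-- Birational antichain rowvacuation `Rvac^B_A`. -/
def RvacAB (κ : ℝ) (rk : P → ℕ) (r : ℕ) : (P → ℝ) → P → ℝ := aApplyB κ rk (arvacWordB r)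

end

noncomputable section

/-- The down-transfer `∇ : F^B_κ(P) → A^B_κ(P)`, `(∇π)(x) = π(x) / ∑_{y ⋖ x} π(y)`. -/
def downT {P : Type} [Fintype P] [PartialOrder P] (π : Phat P → ℝ) : P → ℝ :=
  fun x => π (emb x) / covSumBelow π (emb x)

end

section MaximalChains

variable {P : Type} [PartialOrder P]

lemma IsMaxChain.mem_of_forall_comparable {C : Set P} (hC : IsMaxChain (· ≤ ·) C) {w : P}
    (h : ∀ c ∈ C, w ≤ c ∨ c ≤ w) : w ∈ C := by
  have := hC.2 (hC.1.insert fun c hc _ => h c hc) (Set.subset_insert w C)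
  rw [this]
  exact Set.mem_insert w C

lemma IsMaxChain.exists_covBy_mem [Finite P] {C : Set P} (hC : IsMaxChain (· ≤ ·) C) {x : P}
    (hx : x ∈ C) (hmin : ¬ IsMin x) : ∃ y ∈ C, y ⋖ x := by
  have hne : (C ∩ Set.Iio x).Nonempty := by
    obtain ⟨w, hw⟩ := not_isMin_iff.1 hmin
    by_contra hempty
    refine hempty ⟨w, hC.mem_of_forall_comparable fun c hc => ?_, hw⟩
    rcases hC.1.total hx hc with h | h
    · exact Or.inl (hw.le.trans h)
    · rcases h.eq_or_lt with rfl | h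
      · exact Or.inl hw.le
      · exact (hempty ⟨c, hc, h⟩).elim
  obtain ⟨y, ⟨hyC, hyx⟩, hy⟩ := (Set.toFinite (C ∩ Set.Iio x)).exists_maximal hne
  refine ⟨y, hyC, hyx, fun w hyw hwx => ?_⟩
  have hwC : w ∈ C := hC.mem_of_forall_comparable fun c hc => by
    rcases hC.1.total hx hc with h | h
    · exact Or.inl (hwx.le.trans h)
    · rcases h.eq_or_lt with rfl | h
      · exact Or.inl hwx.le
      · rcases hC.1.total hyC hc with h' | h'
        · exact Or.inr ((hy ⟨hc, h⟩ h').trans hyw.le)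
        · exact Or.inr (h'.trans hyw.le)
  exact (hy ⟨hwC, hwx⟩ hyw.le).not_gt hyw

/-- `B` is a saturated chain with least element `x` and greatest element `z`. -/
structure IsSaturatedChain (x z : P) (B : Set P) : Prop where
  isChain : IsChain (· ≤ ·) B
  left_mem : x ∈ B
  right_mem : z ∈ B
  subset_Icc : B ⊆ Set.Icc x z
  mem_of_comparable : ∀ w ∈ Set.Icc x z, (∀ b ∈ B, w ≤ b ∨ b ≤ w) → w ∈ B

namespace IsSaturatedChain

lemma singleton (x : P) : IsSaturatedChain x x {x} where
  isChain := IsChain.singleton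
  left_mem := rfl
  right_mem := rfl
  subset_Icc := by simp
  mem_of_comparable w hw _ := le_antisymm hw.2 hw.1

lemma dual {x z : P} {B : Set P} (hB : IsSaturatedChain x z B) :
    IsSaturatedChain (OrderDual.toDual z) (OrderDual.toDual x) (OrderDual.ofDual ⁻¹' B) where
  isChain := hB.isChain.symm
  left_mem := hB.right_mem
  right_mem := hB.left_mem
  subset_Icc _ hw := (hB.subset_Icc hw).symm
  mem_of_comparable w hw h :=
    hB.mem_of_comparable (OrderDual.ofDual w) hw.symm fun b hb => (h (OrderDual.toDual b) hb).symm

lemma insert_left {x y z : P} {B : Set P} (hB : IsSaturatedChain x z B) (hy : y ⋖ x) :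
    IsSaturatedChain y z (insert y B) where
  isChain := hB.isChain.insert fun b hb _ => Or.inl (hy.le.trans (hB.subset_Icc hb).1)
  left_mem := Set.mem_insert _ _
  right_mem := Set.mem_insert_of_mem _ hB.right_mem
  subset_Icc := Set.insert_subset
    ⟨le_rfl, hy.le.trans (hB.subset_Icc hB.left_mem).2⟩
    fun b hb => ⟨hy.le.trans (hB.subset_Icc hb).1, (hB.subset_Icc hb).2⟩
  mem_of_comparable w hw h := by
    rcases h x (Set.mem_insert_of_mem _ hB.left_mem) with hwx | hxw
    · rcases hy.eq_or_eq hw.1 hwx with rfl | rfl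
      · exact Set.mem_insert _ _
      · exact Set.mem_insert_of_mem _ hB.left_mem
    · exact Set.mem_insert_of_mem _ (hB.mem_of_comparable w ⟨hxw, hw.2⟩ fun b hb =>
        h b (Set.mem_insert_of_mem _ hb))

lemma isMaxChain {x z : P} {B : Set P} (hB : IsSaturatedChain x z B) (hx : IsMin x)
    (hz : IsMax z) : IsMaxChain (· ≤ ·) B := by
  refine ⟨hB.isChain, fun t ht hBt => hBt.antisymm fun w hw => ?_⟩
  refine hB.mem_of_comparable w ⟨?_, ?_⟩ fun b hb => ht.total hw (hBt hb)
  · exact (ht.total (hBt hB.left_mem) hw).elim id fun h => hx h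
  · exact (ht.total (hBt hB.right_mem) hw).elim (fun h => hz h) id

lemma eq_of_inter_Icc_eq {x z : P} {B C : Set P} (hB : IsSaturatedChain x z B) (hx : IsMin x)
    (hz : IsMax z) (hC : IsChain (· ≤ ·) C) (h : C ∩ Set.Icc x z = B) : C = B := by
  have hBC : B ⊆ C := h ▸ Set.inter_subset_left
  exact ((hB.isMaxChain hx hz).2 hC hBC).symm

lemma inter_Icc_eq_insert {x y z : P} {B C : Set P} (hB : IsSaturatedChain x z B)
    (hC : IsChain (· ≤ ·) C) (h : C ∩ Set.Icc x z = B) (hyC : y ∈ C) (hy : y ⋖ x) :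
    C ∩ Set.Icc y z = insert y B := by
  have hBC : B ⊆ C := h ▸ Set.inter_subset_left
  ext c
  constructor
  · rintro ⟨hc, hyc, hcz⟩
    rcases hC.total (hBC hB.left_mem) hc with hxc | hcx
    · exact Set.mem_insert_of_mem _ (h ▸ ⟨hc, hxc, hcz⟩)
    · rcases hy.eq_or_eq hyc hcx with rfl | rfl
      · exact Set.mem_insert _ _
      · exact Set.mem_insert_of_mem _ hB.left_mem
  · intro hc
    exact ⟨Set.insert_subset hyC hBC hc, (hB.insert_left hy).subset_Icc hc⟩

lemma inter_Icc_eq_of_insert {x y z : P} {B C : Set P} (hB : IsSaturatedChain x z B)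
    (hy : y ⋖ x) (h : C ∩ Set.Icc y z = insert y B) : C ∩ Set.Icc x z = B := by
  ext c
  constructor
  · rintro ⟨hc, hxc, hcz⟩
    have : c ∈ insert y B := h ▸ ⟨hc, hy.le.trans hxc, hcz⟩
    exact this.resolve_left fun hcy => (hcy ▸ hy.lt).not_ge hxc
  · intro hc
    have : c ∈ C ∩ Set.Icc y z := h ▸ Set.mem_insert_of_mem _ hc
    exact ⟨this.1, hB.subset_Icc hc⟩

end IsSaturatedChain

end MaximalChains

section ChainSums

variable {P : Type} [Fintype P] [PartialOrder P]

/-- The sum of `∏ y ∈ C, σ y` over the maximal chains `C` whose trace on `[x, z]` is `B`. -/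
noncomputable def traceChainSum (σ : P → ℝ) (x z : P) (B : Set P) : ℝ :=
  ∑ C : Finset P, if IsMaxChain (· ≤ ·) (C : Set P) ∧ (C : Set P) ∩ Set.Icc x z = B then
    ∏ y ∈ C, σ y else 0

lemma chainSum_eq_traceChainSum (σ : P → ℝ) (x : P) :
    chainSum σ x = traceChainSum σ x x {x} := by
  simp [chainSum, traceChainSum, Finset.sum_filter]

lemma traceChainSum_dual (σ : P → ℝ) (x z : P) (B : Set P) :
    traceChainSum (P := Pᵒᵈ) (σ ∘ OrderDual.ofDual) (OrderDual.toDual z) (OrderDual.toDual x)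
      (OrderDual.ofDual ⁻¹' B) = traceChainSum σ x z B := by
  unfold traceChainSum
  refine Finset.sum_congr rfl fun (C : Finset P) _ => ?_
  refine if_congr (and_congr ⟨IsMaxChain.symm, IsMaxChain.symm⟩ ?_) rfl rfl
  rw [Set.Icc_toDual]
  rfl

lemma traceChainSum_eq_sum_left (σ : P → ℝ) {x z : P} {B : Set P}
    (hB : IsSaturatedChain x z B) (hx : ¬ IsMin x) :
    traceChainSum σ x z B = ∑ y with y ⋖ x, traceChainSum σ y z (insert y B) := by
  unfold traceChainSum
  rw [Finset.sum_comm]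
  refine Finset.sum_congr rfl fun C _ => ?_
  split_ifs with h
  · obtain ⟨hC, hCB⟩ := h
    have hxC : x ∈ (C : Set P) := (hCB ▸ hB.left_mem : x ∈ (C : Set P) ∩ Set.Icc x z).1
    obtain ⟨y, hyC, hy⟩ := hC.exists_covBy_mem hxC hx
    rw [Finset.sum_eq_single_of_mem y (by simpa using hy),
      if_pos ⟨hC, hB.inter_Icc_eq_insert hC.1 hCB hyC hy⟩]
    intro y' hy' hne
    refine if_neg fun h' => hne ?_
    have hy'x : y' ⋖ x := by simpa using hy'
    have hy'C : y' ∈ (C : Set P) :=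
      (h'.2 ▸ Set.mem_insert y' B : y' ∈ (C : Set P) ∩ Set.Icc y' z).1
    rcases hC.1.total hyC hy'C with hle | hle
    · exact (hy.eq_or_eq hle hy'x.le).resolve_right hy'x.ne
    · exact ((hy'x.eq_or_eq hle hy.le).resolve_right hy.ne).symm
  · refine (Finset.sum_eq_zero fun y hy => if_neg fun h' => h ⟨h'.1, ?_⟩).symm
    exact hB.inter_Icc_eq_of_insert (by simpa using hy) h'.2

lemma traceChainSum_of_isMin_of_isMax (σ : P → ℝ) {x z : P} {B : Finset P}
    (hB : IsSaturatedChain x z (B : Set P)) (hx : IsMin x) (hz : IsMax z) :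
    traceChainSum σ x z B = ∏ y ∈ B, σ y := by
  unfold traceChainSum
  rw [Finset.sum_eq_single_of_mem B (Finset.mem_univ B), if_pos]
  · exact ⟨hB.isMaxChain hx hz, Set.inter_eq_left.2 hB.subset_Icc⟩
  · intro C _ hne
    refine if_neg fun h => hne ?_
    exact_mod_cast hB.eq_of_inter_Icc_eq hx hz h.1.1 h.2

lemma sum_covBy_eq_zero {x : P} (hx : IsMin x) (f : P → ℝ) : ∑ w with w ⋖ x, f w = 0 := by
  refine Finset.sum_eq_zero fun w hw => ?_
  exact (hx.not_lt (Finset.mem_filter.1 hw).2.lt).elim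

/-- If `A` satisfies the recursion for sums over saturated chains going down to a minimal
element, then extending a chain downwards multiplies the weight by `A`. -/
lemma traceChainSum_eq_mul_left (σ A : P → ℝ) {z : P} (c : ℝ)
    (hc : ∀ x (B : Finset P), IsSaturatedChain x z (B : Set P) → IsMin x →
      traceChainSum σ x z B = (∏ y ∈ B, σ y) * c) (x : P)
    (hA : ∀ y ≤ x, A y = (if IsMin y then 1 else 0) + ∑ w with w ⋖ y, σ w * A w)
    (B : Finset P) (hB : IsSaturatedChain x z (B : Set P)) :
    traceChainSum σ x z B = A x * (∏ y ∈ B, σ y) * c := by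
  induction x using WellFoundedLT.induction generalizing B with
  | ind x ih =>
    rw [hA x le_rfl]
    by_cases hx : IsMin x
    · rw [hc x B hB hx, if_pos hx, sum_covBy_eq_zero hx]
      ring
    · rw [traceChainSum_eq_sum_left σ hB hx, if_neg hx, zero_add, Finset.sum_mul, Finset.sum_mul]
      refine Finset.sum_congr rfl fun y hy => ?_
      have hyx : y ⋖ x := by simpa using hy
      have hyB : y ∉ B := fun h => (hB.subset_Icc h).1.not_gt hyx.lt
      have := ih y hyx.lt (fun w hw => hA w (hw.trans hyx.le)) (insert y B)
        (by simpa using hB.insert_left hyx)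
      rw [Finset.coe_insert] at this
      rw [this, Finset.prod_insert hyB]
      ring

lemma traceChainSum_eq_mul_right (σ U : P → ℝ) {x : P} (hx : IsMin x) (z : P)
    (hU : ∀ y ≥ z, U y = (if IsMax y then 1 else 0) + ∑ w with y ⋖ w, σ w * U w)
    (B : Finset P) (hB : IsSaturatedChain x z (B : Set P)) :
    traceChainSum σ x z B = (∏ y ∈ B, σ y) * U z := by
  have key := traceChainSum_eq_mul_left (P := Pᵒᵈ) (σ ∘ OrderDual.ofDual) (U ∘ OrderDual.ofDual)
    (z := OrderDual.toDual x) 1 (fun y B' hB' hy => ?_) (OrderDual.toDual z)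
    (fun y hy => ?_) B hB.dual
  · rw [← traceChainSum_dual]
    refine key.trans ?_
    rw [mul_one, mul_comm]
    rfl
  · rw [mul_one]
    exact traceChainSum_of_isMin_of_isMax (P := Pᵒᵈ) _ hB' hy hx.toDual
  · refine (hU (OrderDual.ofDual y) hy).trans ?_
    congr 1
    exact Finset.sum_congr (Finset.filter_congr fun w _ => toDual_covBy_toDual_iff.symm)
      fun _ _ => rfl

theorem chainSum_eq_mul (σ A U : P → ℝ) (x : P)
    (hA : ∀ y ≤ x, A y = (if IsMin y then 1 else 0) + ∑ w with w ⋖ y, σ w * A w)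
    (hU : ∀ y ≥ x, U y = (if IsMax y then 1 else 0) + ∑ w with y ⋖ w, σ w * U w) :
    chainSum σ x = A x * σ x * U x := by
  have hB : IsSaturatedChain x x (({x} : Finset P) : Set P) := by
    simpa using IsSaturatedChain.singleton x
  have := traceChainSum_eq_mul_left σ A (U x)
    (fun y B hB hy => traceChainSum_eq_mul_right σ U hy x hU B hB) x hA {x} hB
  rw [Finset.coe_singleton, Finset.prod_singleton] at this
  rw [chainSum_eq_traceChainSum, this]

end ChainSums

section PhatOrder

variable {P : Type}

lemma Phat.cases_emb (x : Phat P) : x = ⊥ ∨ x = topHat P ∨ ∃ p, x = emb p :=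
  match x with
  | none => Or.inl rfl
  | some none => Or.inr (Or.inl rfl)
  | some (some p) => Or.inr (Or.inr ⟨p, rfl⟩)

lemma emb_injective : Function.Injective (emb : P → Phat P) := fun _ _ h =>
  WithTop.coe_injective (WithBot.coe_injective h)

lemma emb_ne_bot (p : P) : emb p ≠ ⊥ := WithBot.coe_ne_bot

lemma topHat_ne_emb (p : P) : topHat P ≠ emb p := fun h =>
  WithTop.top_ne_coe (WithBot.coe_injective h)

lemma Phat.funext_emb {π π' : Phat P → ℝ} (hbot : π ⊥ = π' ⊥)
    (htop : π (topHat P) = π' (topHat P)) (h : ∀ p, π (emb p) = π' (emb p)) : π = π' := by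
  funext x
  rcases Phat.cases_emb x with rfl | rfl | ⟨p, rfl⟩
  exacts [hbot, htop, h p]

lemma Phat.sum_eq [Fintype P] (f : Phat P → ℝ) :
    ∑ y, f y = f ⊥ + (f (topHat P) + ∑ p, f (emb p)) := by
  refine (Fintype.sum_option (α := Option P) f).trans ?_
  exact congrArg _ (Fintype.sum_option (α := P) fun y => f (Option.some y))

variable [PartialOrder P]

lemma emb_covBy_emb {x y : P} : emb x ⋖ emb y ↔ x ⋖ y :=
  WithBot.coe_covBy_coe.trans WithTop.coe_covBy_coe

lemma bot_covBy_emb {x : P} : ⊥ ⋖ emb x ↔ IsMin x := by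
  refine WithBot.bot_covBy_coe.trans ⟨fun h y hy => ?_, fun h y hy => ?_⟩
  · exact WithTop.coe_le_coe.1 (h (WithTop.coe_le_coe.2 hy))
  · obtain ⟨y, rfl, hyx⟩ := WithTop.le_coe_iff.1 hy
    exact WithTop.coe_le_coe.2 (h hyx)

lemma emb_covBy_topHat {x : P} : emb x ⋖ topHat P ↔ IsMax x :=
  WithBot.coe_covBy_coe.trans WithTop.coe_covBy_top

lemma not_topHat_covBy_emb {x : P} : ¬ topHat P ⋖ emb x := fun h =>
  not_top_lt (WithBot.coe_lt_coe.1 h.lt)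

variable [Fintype P]

lemma covSumBelow_emb (π : Phat P → ℝ) (x : P) :
    covSumBelow π (emb x) = (if IsMin x then π ⊥ else 0) + ∑ w with w ⋖ x, π (emb w) := by
  simp [covSumBelow, Phat.sum_eq, emb_covBy_emb, -bot_covBy_iff, bot_covBy_emb,
    not_topHat_covBy_emb, Finset.sum_filter]

lemma covSumAboveInv_emb (π : Phat P → ℝ) (x : P) :
    covSumAboveInv π (emb x) =
      (if IsMax x then (π (topHat P))⁻¹ else 0) + ∑ w with x ⋖ w, (π (emb w))⁻¹ := by
  simp [covSumAboveInv, Phat.sum_eq, emb_covBy_emb, emb_covBy_topHat, not_covBy_bot,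
    Finset.sum_filter]

lemma covSumBelow_emb_congr {π π' : Phat P → ℝ} {x : P} (hbot : π ⊥ = π' ⊥)
    (h : ∀ w, w ⋖ x → π (emb w) = π' (emb w)) :
    covSumBelow π (emb x) = covSumBelow π' (emb x) := by
  rw [covSumBelow_emb, covSumBelow_emb, hbot]
  exact congrArg _ (Finset.sum_congr rfl fun w hw => h w (by simpa using hw))

lemma covSumAboveInv_emb_congr {π π' : Phat P → ℝ} {x : P} (htop : π (topHat P) = π' (topHat P))
    (h : ∀ w, x ⋖ w → π (emb w) = π' (emb w)) :
    covSumAboveInv π (emb x) = covSumAboveInv π' (emb x) := by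
  rw [covSumAboveInv_emb, covSumAboveInv_emb, htop]
  exact congrArg _ (Finset.sum_congr rfl fun w hw => by rw [h w (by simpa using hw)])

lemma covSumBelow_emb_pos {π : Phat P → ℝ} (hπ : ∀ x, 0 < π x) (x : P) :
    0 < covSumBelow π (emb x) := by
  rw [covSumBelow_emb]
  by_cases hx : IsMin x
  · rw [if_pos hx]
    exact add_pos_of_pos_of_nonneg (hπ _) (Finset.sum_nonneg fun w _ => (hπ _).le)
  · obtain ⟨y, hy⟩ := not_isMin_iff.1 hx
    obtain ⟨w, -, hw⟩ := exists_le_covBy_of_lt hy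
    rw [if_neg hx, zero_add]
    exact Finset.sum_pos (fun w _ => hπ _) ⟨w, by simpa using hw⟩

lemma covSumAboveInv_emb_pos {π : Phat P → ℝ} (hπ : ∀ x, 0 < π x) (x : P) :
    0 < covSumAboveInv π (emb x) := by
  rw [covSumAboveInv_emb]
  by_cases hx : IsMax x
  · rw [if_pos hx]
    exact add_pos_of_pos_of_nonneg (inv_pos.2 (hπ _))
      (Finset.sum_nonneg fun w _ => (inv_pos.2 (hπ _)).le)
  · obtain ⟨y, hy⟩ := not_isMax_iff.1 hx
    obtain ⟨w, hw, -⟩ := exists_covBy_le_of_lt hy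
    rw [if_neg hx, zero_add]
    exact Finset.sum_pos (fun w _ => inv_pos.2 (hπ _)) ⟨w, by simpa using hw⟩

end PhatOrder

section RankToggles

variable {P : Type} [Fintype P] [PartialOrder P]

lemma rankToggleB_bot (rk : P → ℕ) (i : ℕ) (π : Phat P → ℝ) : rankToggleB rk i π ⊥ = π ⊥ :=
  if_neg fun ⟨p, _, hp⟩ => emb_ne_bot p hp.symm

lemma rankToggleB_topHat (rk : P → ℕ) (i : ℕ) (π : Phat P → ℝ) :
    rankToggleB rk i π (topHat P) = π (topHat P) :=
  if_neg fun ⟨p, _, hp⟩ => topHat_ne_emb p hp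

lemma rankToggleB_emb_of_eq {rk : P → ℕ} {i : ℕ} (π : Phat P → ℝ) {p : P} (hp : rk p = i) :
    rankToggleB rk i π (emb p) =
      covSumBelow π (emb p) / (π (emb p) * covSumAboveInv π (emb p)) :=
  if_pos ⟨p, hp, rfl⟩

lemma rankToggleB_emb_of_ne {rk : P → ℕ} {i : ℕ} (π : Phat P → ℝ) {p : P} (hp : rk p ≠ i) :
    rankToggleB rk i π (emb p) = π (emb p) :=
  if_neg fun ⟨_, hq, h⟩ => hp (emb_injective h ▸ hq)

variable {rk : P → ℕ} (hcov : ∀ x y : P, x ⋖ y → rk y = rk x + 1)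
include hcov

lemma covSumBelow_rankToggleB {i : ℕ} (π : Phat P → ℝ) {p : P} (hp : rk p ≠ i + 1) :
    covSumBelow (rankToggleB rk i π) (emb p) = covSumBelow π (emb p) :=
  covSumBelow_emb_congr (rankToggleB_bot _ _ _) fun w hw =>
    rankToggleB_emb_of_ne _ (by have := hcov w p hw; omega)

lemma covSumAboveInv_rankToggleB {i : ℕ} (π : Phat P → ℝ) {p : P} (hp : i ≠ rk p + 1) :
    covSumAboveInv (rankToggleB rk i π) (emb p) = covSumAboveInv π (emb p) :=
  covSumAboveInv_emb_congr (rankToggleB_topHat _ _ _) fun w hw =>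
    rankToggleB_emb_of_ne _ (by have := hcov p w hw; omega)

lemma rankToggleB_rankToggleB (i : ℕ) {π : Phat P → ℝ} (hπ : ∀ x, 0 < π x) :
    rankToggleB rk i (rankToggleB rk i π) = π := by
  refine Phat.funext_emb (by simp only [rankToggleB_bot]) (by simp only [rankToggleB_topHat])
    fun p => ?_
  by_cases hp : rk p = i
  · rw [rankToggleB_emb_of_eq _ hp, covSumBelow_rankToggleB hcov _ (by omega),
      covSumAboveInv_rankToggleB hcov _ (by omega), rankToggleB_emb_of_eq _ hp]
    have h₁ := (covSumBelow_emb_pos hπ p).ne'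
    have h₂ := (covSumAboveInv_emb_pos hπ p).ne'
    have h₃ := (hπ (emb p)).ne'
    field_simp
  · rw [rankToggleB_emb_of_ne _ hp, rankToggleB_emb_of_ne _ hp]

lemma rankToggleB_comm {i j : ℕ} (hij : i + 1 < j) (π : Phat P → ℝ) :
    rankToggleB rk i (rankToggleB rk j π) = rankToggleB rk j (rankToggleB rk i π) := by
  refine Phat.funext_emb (by simp only [rankToggleB_bot]) (by simp only [rankToggleB_topHat])
    fun p => ?_
  by_cases hi : rk p = i
  · rw [rankToggleB_emb_of_eq _ hi, rankToggleB_emb_of_ne _ (by omega : rk p ≠ j),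
      rankToggleB_emb_of_ne _ (by omega : rk p ≠ j), rankToggleB_emb_of_eq _ hi,
      covSumBelow_rankToggleB hcov _ (by omega), covSumAboveInv_rankToggleB hcov _ (by omega)]
  · by_cases hj : rk p = j
    · rw [rankToggleB_emb_of_ne _ hi, rankToggleB_emb_of_eq _ hj, rankToggleB_emb_of_eq _ hj,
        rankToggleB_emb_of_ne _ hi, covSumBelow_rankToggleB hcov _ (by omega),
        covSumAboveInv_rankToggleB hcov _ (by omega)]
    · simp only [rankToggleB_emb_of_ne _ hi, rankToggleB_emb_of_ne _ hj]

omit hcov in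
lemma rankToggleB_pos (rk : P → ℕ) (i : ℕ) {π : Phat P → ℝ} (hπ : ∀ x, 0 < π x) (x : Phat P) :
    0 < rankToggleB rk i π x := by
  unfold rankToggleB
  split_ifs with h
  · obtain ⟨p, -, rfl⟩ := h
    exact div_pos (covSumBelow_emb_pos hπ p) (mul_pos (hπ _) (covSumAboveInv_emb_pos hπ p))
  · exact hπ x

end RankToggles

section WordProducts

variable {G : Type*} [Group G]

/-- The product `s (n - 1) * ⋯ * s 1 * s 0`. -/
def rowProd (s : ℕ → G) : ℕ → G
  | 0 => 1
  | n + 1 => s n * rowProd s n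

/-- The product `(s 0) * (s 1 * s 0) * ⋯ * (s (n - 1) * ⋯ * s 0)`. -/
def vacProd (s : ℕ → G) : ℕ → G
  | 0 => 1
  | n + 1 => vacProd s n * rowProd s (n + 1)

variable {s : ℕ → G} {N : ℕ}

lemma commute_rowProd {g : G} {n : ℕ} (h : ∀ i < n, Commute g (s i)) :
    Commute g (rowProd s n) := by
  induction n with
  | zero => exact Commute.one_right g
  | succ n ih =>
    exact (h n n.lt_succ_self).mul_right (ih fun i hi => h i (hi.trans n.lt_succ_self))

lemma commute_vacProd {g : G} {n : ℕ} (h : ∀ i < n, Commute g (s i)) :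
    Commute g (vacProd s n) := by
  induction n with
  | zero => exact Commute.one_right g
  | succ n ih =>
    exact (ih fun i hi => h i (hi.trans n.lt_succ_self)).mul_right (commute_rowProd h)

lemma vacProd_succ_eq_inv_mul (hinv : ∀ i, s i * s i = 1)
    (hcomm : ∀ i j, i + 1 < j → j < N → Commute (s j) (s i)) {n : ℕ} (hn : n < N) :
    vacProd s (n + 1) = (rowProd s (n + 1))⁻¹ * vacProd s n := by
  induction n with
  | zero => simpa [vacProd, rowProd] using eq_inv_of_mul_eq_one_left (hinv 0)
  | succ n ih =>
    have hs : s (n + 1) = (s (n + 1))⁻¹ := eq_inv_of_mul_eq_one_left (hinv _)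
    have hc : vacProd s n * s (n + 1) = s (n + 1) * vacProd s n :=
      (commute_vacProd fun i hi => hcomm i (n + 1) (by omega) hn).eq.symm
    calc vacProd s (n + 1 + 1)
        = vacProd s (n + 1) * (s (n + 1) * rowProd s (n + 1)) := rfl
      _ = (rowProd s (n + 1))⁻¹ * (vacProd s n * s (n + 1)) * rowProd s (n + 1) := by
          rw [ih (by omega)]; group
      _ = (rowProd s (n + 1))⁻¹ * s (n + 1) * (vacProd s n * rowProd s (n + 1)) := by
          rw [hc]; group
      _ = (rowProd s (n + 1))⁻¹ * (s (n + 1))⁻¹ * vacProd s (n + 1) := by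
          rw [← hs]; rfl
      _ = (rowProd s (n + 1 + 1))⁻¹ * vacProd s (n + 1) := by
          rw [← mul_inv_rev]; rfl

lemma vacProd_mul_self (hinv : ∀ i, s i * s i = 1)
    (hcomm : ∀ i j, i + 1 < j → j < N → Commute (s j) (s i)) {n : ℕ} (hn : n ≤ N) :
    vacProd s n * vacProd s n = 1 := by
  induction n with
  | zero => exact one_mul 1
  | succ n ih =>
    nth_rewrite 1 [vacProd_succ_eq_inv_mul hinv hcomm hn]
    rw [vacProd, mul_assoc, ← mul_assoc (vacProd s n), ih (by omega), one_mul, inv_mul_cancel]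

lemma rowProd_mul_vacProd_mul_rowProd (hinv : ∀ i, s i * s i = 1)
    (hcomm : ∀ i j, i + 1 < j → j < N → Commute (s j) (s i)) {n : ℕ} (hn : n < N) :
    rowProd s (n + 1) * vacProd s (n + 1) * rowProd s (n + 1) = vacProd s (n + 1) := by
  nth_rewrite 1 [vacProd_succ_eq_inv_mul hinv hcomm hn]
  rw [mul_inv_cancel_left]
  rfl

end WordProducts

section Words

variable {P : Type} [Fintype P] [PartialOrder P]

lemma applyB_append (rk : P → ℕ) (u v : List ℕ) (π : Phat P → ℝ) :
    applyB rk (u ++ v) π = applyB rk u (applyB rk v π) := by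
  induction u with
  | nil => rfl
  | cons i u ih => exact congrArg (rankToggleB rk i) ih

lemma aApplyB_append (κ : ℝ) (rk : P → ℕ) (u v : List ℕ) (σ : P → ℝ) :
    aApplyB κ rk (u ++ v) σ = aApplyB κ rk u (aApplyB κ rk v σ) := by
  induction u with
  | nil => rfl
  | cons i u ih => exact congrArg (arankToggleB κ rk i) ih

lemma foldr_append_eq_flatMap (f : ℕ → List ℕ) (l : List ℕ) :
    l.foldr (fun k acc => f k ++ acc) [] = l.flatMap f := by
  induction l with
  | nil => rfl
  | cons k l ih => rw [List.foldr_cons, ih, List.flatMap_cons]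

lemma applyB_bot (rk : P → ℕ) (w : List ℕ) (π : Phat P → ℝ) : applyB rk w π ⊥ = π ⊥ := by
  induction w with
  | nil => rfl
  | cons i w ih => exact (rankToggleB_bot _ _ _).trans ih

lemma applyB_topHat (rk : P → ℕ) (w : List ℕ) (π : Phat P → ℝ) :
    applyB rk w π (topHat P) = π (topHat P) := by
  induction w with
  | nil => rfl
  | cons i w ih => exact (rankToggleB_topHat _ _ _).trans ih

lemma applyB_pos (rk : P → ℕ) (w : List ℕ) {π : Phat P → ℝ} (hπ : ∀ x, 0 < π x) (x : Phat P) :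
    0 < applyB rk w π x := by
  induction w generalizing x with
  | nil => exact hπ x
  | cons i w ih => exact rankToggleB_pos rk i ih x

lemma applyB_range'_emb {rk : P → ℕ} (hcov : ∀ x y : P, x ⋖ y → rk y = rk x + 1) (i n : ℕ)
    (π : Phat P → ℝ) (p : P) :
    applyB rk (List.range' i n) π (emb p) =
      if i ≤ rk p ∧ rk p < i + n then
        covSumBelow π (emb p) /
          (π (emb p) * covSumAboveInv (applyB rk (List.range' i n) π) (emb p))
      else π (emb p) := by
  induction n generalizing i p with
  | zero => rw [if_neg (by omega)]; rfl
  | succ n ih =>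
    change rankToggleB rk i (applyB rk (List.range' (i + 1) n) π) (emb p) =
      if _ then _ / (_ * covSumAboveInv
        (rankToggleB rk i (applyB rk (List.range' (i + 1) n) π)) (emb p)) else _
    by_cases hp : rk p = i
    · rw [rankToggleB_emb_of_eq _ hp, if_pos (by omega),
        covSumAboveInv_rankToggleB hcov _ (by omega), ih, if_neg (by omega)]
      congr 1
      exact covSumBelow_emb_congr (applyB_bot _ _ _) fun w hw => by
        have := hcov w p hw
        rw [ih, if_neg (by omega)]
    · rw [rankToggleB_emb_of_ne _ hp, ih]
      by_cases hp' : i + 1 ≤ rk p ∧ rk p < i + 1 + n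
      · rw [if_pos hp', if_pos (by omega), covSumAboveInv_rankToggleB hcov _ (by omega)]
      · rw [if_neg hp', if_neg (by omega)]

end Words

section DownTransfer

variable {P : Type} [Fintype P] [PartialOrder P] {rk : P → ℕ}

lemma strictMono_of_covBy_eq_succ (hcov : ∀ x y : P, x ⋖ y → rk y = rk x + 1) :
    StrictMono rk := by
  intro a b hab
  induction b using WellFoundedLT.induction with
  | ind b ih =>
    obtain ⟨c, hac, hcb⟩ := exists_le_covBy_of_lt hab
    have := hcov c b hcb
    rcases hac.eq_or_lt with rfl | hac
    · omega
    · have := ih c hcb.lt hac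
      omega

lemma rk_le_of_isMax_eq {r : ℕ} (hrk : StrictMono rk) (hmax : ∀ x : P, IsMax x → rk x = r)
    (x : P) : rk x ≤ r := by
  obtain ⟨y, hxy, hy⟩ := (Set.toFinite (Set.univ : Set P)).exists_le_maximal (Set.mem_univ x)
  rw [← hmax y fun z hz => hy.2 (Set.mem_univ z) hz]
  exact hrk.monotone hxy

lemma downT_mul_covSumBelow {π : Phat P → ℝ} (hπ : ∀ x, 0 < π x) (x : P) :
    downT π x * covSumBelow π (emb x) = π (emb x) :=
  div_mul_cancel₀ _ (covSumBelow_emb_pos hπ x).ne'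

lemma downT_applyB_of_lt (hcov : ∀ x y : P, x ⋖ y → rk y = rk x + 1) (i n : ℕ)
    (π : Phat P → ℝ) {p : P} (hp : rk p < i) :
    downT (applyB rk (List.range' i n) π) p = downT π p := by
  unfold downT
  rw [applyB_range'_emb hcov, if_neg (by omega)]
  congr 1
  exact covSumBelow_emb_congr (applyB_bot _ _ _) fun w hw => by
    have := hcov w p hw
    rw [applyB_range'_emb hcov, if_neg (by omega)]

/-- Toggling the ranks `i, …, i + m - 1` of `∇ π` upwards produces the down-transfer of
`𝐭_i ⋯ 𝐭_r π` on all elements of rank less than `i + m`. -/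
lemma aApplyB_downT (hcov : ∀ x y : P, x ⋖ y → rk y = rk x + 1) {κ : ℝ} {π : Phat P → ℝ}
    (hπ : ∀ x, 0 < π x) (hbot : π ⊥ = 1) (htop : π (topHat P) = κ) {i n m : ℕ} (hm : m ≤ n)
    (hn : ∀ p, rk p < i + n) (p : P) :
    aApplyB κ rk (List.range' i m).reverse (downT π) p =
      if rk p < i + m then downT (applyB rk (List.range' i n) π) p else downT π p := by
  set g := applyB rk (List.range' i n) π with hg
  have hgpos : ∀ x, 0 < g x := applyB_pos rk _ hπ
  have hκ : 0 < κ := htop ▸ hπ _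
  have hg_eq : ∀ p, i ≤ rk p → g (emb p) =
      covSumBelow π (emb p) / (π (emb p) * covSumAboveInv g (emb p)) := fun p hp => by
    rw [hg, applyB_range'_emb hcov, if_pos ⟨hp, hn p⟩]
  induction m generalizing p with
  | zero =>
    split_ifs with h
    · exact (downT_applyB_of_lt hcov i n π h).symm
    · rfl
  | succ m ih =>
    rw [List.range'_concat, List.reverse_append, one_mul]
    change arankToggleB κ rk (i + m) (aApplyB κ rk (List.range' i m).reverse (downT π)) p = _
    set σ := aApplyB κ rk (List.range' i m).reverse (downT π)
    replace ih := ih (by omega)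
    unfold arankToggleB
    by_cases hp : rk p = i + m
    · have hrk := strictMono_of_covBy_eq_succ hcov
      rw [if_pos hp, if_pos (by omega), chainSum_eq_mul σ (fun y => covSumBelow g (emb y))
        (fun y => κ * covSumAboveInv g (emb y)), ih, if_neg (by omega)]
      · have h₁ := (covSumBelow_emb_pos hgpos p).ne'
        have h₂ := (covSumBelow_emb_pos hπ p).ne'
        have h₃ := (covSumAboveInv_emb_pos hgpos p).ne'
        have h₄ := (hπ (emb p)).ne'
        unfold downT
        rw [hg_eq p (by omega)]
        field_simp
      · intro y hy
        have hyp := hrk.monotone hy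
        rw [covSumBelow_emb, hg, applyB_bot, hbot, ← hg]
        refine congrArg _ (Finset.sum_congr rfl fun w hw => ?_)
        have := hcov w y (by simpa using hw)
        rw [ih, if_pos (by omega), downT_mul_covSumBelow hgpos]
      · intro y hy
        have hyp := hrk.monotone hy
        rw [covSumAboveInv_emb, hg, applyB_topHat, htop, ← hg, mul_add, mul_ite,
          mul_inv_cancel₀ hκ.ne', mul_zero, Finset.mul_sum]
        refine congrArg _ (Finset.sum_congr rfl fun w hw => ?_)
        have := hcov y w (by simpa using hw)
        rw [ih, if_neg (by omega), hg_eq w (by omega), downT, inv_div]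
        ring
    · rw [if_neg hp, ih]
      by_cases hp' : rk p < i + m
      · rw [if_pos hp', if_pos (by omega)]
      · rw [if_neg hp', if_neg (by omega)]

lemma downT_applyB_range' (hcov : ∀ x y : P, x ⋖ y → rk y = rk x + 1) {κ : ℝ} {π : Phat P → ℝ}
    (hπ : ∀ x, 0 < π x) (hbot : π ⊥ = 1) (htop : π (topHat P) = κ) {i n : ℕ}
    (hn : ∀ p, rk p < i + n) :
    downT (applyB rk (List.range' i n) π) =
      aApplyB κ rk (List.range' i n).reverse (downT π) := by
  funext p
  rw [aApplyB_downT hcov hπ hbot htop le_rfl hn, if_pos (hn p)]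

lemma downT_applyB_flatMap {κ : ℝ} {f g : ℕ → List ℕ}
    {l : List ℕ} (h : ∀ k ∈ l, ∀ π : Phat P → ℝ, (∀ x, 0 < π x) → π ⊥ = 1 → π (topHat P) = κ →
      downT (applyB rk (f k) π) = aApplyB κ rk (g k) (downT π))
    {π : Phat P → ℝ} (hπ : ∀ x, 0 < π x) (hbot : π ⊥ = 1) (htop : π (topHat P) = κ) :
    downT (applyB rk (l.flatMap f) π) = aApplyB κ rk (l.flatMap g) (downT π) := by
  induction l with
  | nil => rfl
  | cons k l ih =>
    rw [List.flatMap_cons, List.flatMap_cons, applyB_append, aApplyB_append,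
      h k List.mem_cons_self _ (applyB_pos rk _ hπ) ((applyB_bot _ _ _).trans hbot)
        ((applyB_topHat _ _ _).trans htop),
      ih fun k' hk' => h k' (List.mem_cons_of_mem _ hk')]

lemma downT_RowB (hcov : ∀ x y : P, x ⋖ y → rk y = rk x + 1) {r : ℕ} (hr : ∀ p, rk p ≤ r)
    {κ : ℝ} {π : Phat P → ℝ} (hπ : ∀ x, 0 < π x) (hbot : π ⊥ = 1) (htop : π (topHat P) = κ) :
    downT (RowB rk r π) = RowAB κ rk r (downT π) := by
  unfold RowB RowAB rowWordB arowWordB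
  rw [List.range_eq_range']
  exact downT_applyB_range' hcov hπ hbot htop fun p => by have := hr p; omega

lemma downT_RvacB (hcov : ∀ x y : P, x ⋖ y → rk y = rk x + 1) {r : ℕ} (hr : ∀ p, rk p ≤ r)
    {κ : ℝ} {π : Phat P → ℝ} (hπ : ∀ x, 0 < π x) (hbot : π ⊥ = 1) (htop : π (topHat P) = κ) :
    downT (RvacB rk r π) = RvacAB κ rk r (downT π) := by
  unfold RvacB RvacAB rvacWordB arvacWordB
  rw [foldr_append_eq_flatMap, foldr_append_eq_flatMap]
  refine downT_applyB_flatMap (fun k hk π hπ hbot htop => ?_) hπ hbot htop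
  have hk : k < r + 1 := List.mem_range.1 hk
  rw [List.take_reverse, List.length_range, show r + 1 - (k + 1) = r - k by omega,
    List.range_eq_range', List.drop_range']
  exact downT_applyB_range' hcov hπ hbot htop fun p => by have := hr p; omega

/-- The down-transfer is surjective onto the positive labelings. -/
lemma exists_downT_eq {κ : ℝ} (hκ : 0 < κ) {σ : P → ℝ} (hσ : ∀ x, 0 < σ x) :
    ∃ π : Phat P → ℝ, (∀ x, 0 < π x) ∧ π ⊥ = 1 ∧ π (topHat P) = κ ∧ downT π = σ := by
  let F (x : P) (f : (y : P) → y < x → ℝ) : ℝ :=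
    σ x * ((if IsMin x then 1 else 0) + ∑ w, if h : w ⋖ x then f w h.lt else 0)
  let f : P → ℝ := (wellFounded_lt (α := P)).fix F
  let π : Phat P → ℝ
    | none => 1
    | some none => κ
    | some (some p) => f p
  have hπ_emb : ∀ p, π (emb p) = σ p * covSumBelow π (emb p) := fun p => by
    rw [covSumBelow_emb, Finset.sum_filter]
    refine ((wellFounded_lt (α := P)).fix_eq F p).trans ?_
    simp only [F, dite_eq_ite]
    rfl
  have hπ : ∀ p, 0 < π (emb p) := fun p => by
    induction p using WellFoundedLT.induction with
    | ind p ih =>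
      rw [hπ_emb, covSumBelow_emb]
      refine mul_pos (hσ p) ?_
      by_cases hp : IsMin p
      · rw [if_pos hp, sum_covBy_eq_zero hp, add_zero]
        exact one_pos
      · obtain ⟨y, hy⟩ := not_isMin_iff.1 hp
        obtain ⟨w, -, hw⟩ := exists_le_covBy_of_lt hy
        rw [if_neg hp, zero_add]
        exact Finset.sum_pos (fun w hw => ih w (Finset.mem_filter.1 hw).2.lt)
          ⟨w, by simpa using hw⟩
  have hpos : ∀ x, 0 < π x := fun x => by
    rcases Phat.cases_emb x with rfl | rfl | ⟨p, rfl⟩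
    exacts [one_pos, hκ, hπ p]
  refine ⟨π, hpos, rfl, rfl, funext fun p => ?_⟩
  rw [downT, div_eq_iff (covSumBelow_emb_pos hpos p).ne', hπ_emb]

end DownTransfer

section TogglePerm

variable {P : Type} [Fintype P] [PartialOrder P] {rk : P → ℕ}

/-- The rank toggle `𝐭_i` as a permutation of the positive labelings of `P̂`. -/
noncomputable def togglePerm (hcov : ∀ x y : P, x ⋖ y → rk y = rk x + 1) (i : ℕ) :
    Equiv.Perm {π : Phat P → ℝ // ∀ x, 0 < π x} :=
  Function.Involutive.toPerm (fun π => ⟨rankToggleB rk i π.1, rankToggleB_pos rk i π.2⟩)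
    fun π => Subtype.ext (rankToggleB_rankToggleB hcov i π.2)

variable (hcov : ∀ x y : P, x ⋖ y → rk y = rk x + 1)

lemma togglePerm_mul_self (i : ℕ) : togglePerm hcov i * togglePerm hcov i = 1 :=
  Equiv.ext fun π => Subtype.ext (rankToggleB_rankToggleB hcov i π.2)

lemma togglePerm_commute {i j : ℕ} (hij : i + 1 < j) :
    Commute (togglePerm hcov i) (togglePerm hcov j) :=
  Equiv.ext fun π => Subtype.ext (rankToggleB_comm hcov hij π.1)

lemma coe_prod_togglePerm (w : List ℕ) (π : {π : Phat P → ℝ // ∀ x, 0 < π x}) :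
    ((w.map (togglePerm hcov)).prod π).1 = applyB rk w π.1 := by
  induction w with
  | nil => rfl
  | cons i w ih =>
    rw [List.map_cons, List.prod_cons]
    exact congrArg (rankToggleB rk i) ih

lemma prod_map_drop_range {G : Type*} [Group G] (t : ℕ → G) {r k : ℕ} (hk : k ≤ r) :
    (((List.range (r + 1)).drop (r - k)).map t).prod = rowProd (fun i => t (r - i)) (k + 1) := by
  rw [List.range_eq_range', List.drop_range', show r + 1 - (r - k) = k + 1 by omega]
  induction k with
  | zero => simp [rowProd]
  | succ k ih =>
    rw [List.range'_succ, List.map_cons, List.prod_cons, rowProd, ← ih (by omega),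
      show 0 + (r - (k + 1)) * 1 + 1 = 0 + (r - k) * 1 by omega]
    simp

lemma prod_map_rowWordB {G : Type*} [Group G] (t : ℕ → G) (r : ℕ) :
    ((rowWordB r).map t).prod = rowProd (fun i => t (r - i)) (r + 1) := by
  rw [← prod_map_drop_range t le_rfl, Nat.sub_self, List.drop_zero, rowWordB]

lemma prod_map_rvacWordB {G : Type*} [Group G] (t : ℕ → G) (r : ℕ) :
    ((rvacWordB r).map t).prod = vacProd (fun i => t (r - i)) (r + 1) := by
  have key : ∀ n ≤ r + 1, (((List.range n).flatMap fun k =>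
      (List.range (r + 1)).drop (r - k)).map t).prod = vacProd (fun i => t (r - i)) n := by
    intro n hn
    induction n with
    | zero => rfl
    | succ n ih =>
      rw [List.range_succ (n := n), List.flatMap_append, List.map_append, List.prod_append, ih (by omega),
        List.flatMap_singleton, prod_map_drop_range t (by omega)]
      rfl
  rw [rvacWordB, foldr_append_eq_flatMap, key _ le_rfl]

include hcov

lemma RvacB_RvacB (r : ℕ) {π : Phat P → ℝ} (hπ : ∀ x, 0 < π x) :
    RvacB rk r (RvacB rk r π) = π := by
  have h := vacProd_mul_self (s := fun i => togglePerm hcov (r - i)) (N := r + 1)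
    (fun i => togglePerm_mul_self hcov _)
    (fun i j hij hj => togglePerm_commute hcov (by omega)) le_rfl
  rw [← prod_map_rvacWordB, ← List.prod_append, ← List.map_append] at h
  have := congrArg (fun e : Equiv.Perm _ => (e ⟨π, hπ⟩).1) h
  simp only [coe_prod_togglePerm, applyB_append] at this
  exact this

lemma RowB_RvacB_RowB (r : ℕ) {π : Phat P → ℝ} (hπ : ∀ x, 0 < π x) :
    RowB rk r (RvacB rk r (RowB rk r π)) = RvacB rk r π := by
  have h := rowProd_mul_vacProd_mul_rowProd (s := fun i => togglePerm hcov (r - i)) (N := r + 1)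
    (fun i => togglePerm_mul_self hcov _)
    (fun i j hij hj => togglePerm_commute hcov (by omega)) r.lt_succ_self
  rw [← prod_map_rvacWordB, ← prod_map_rowWordB, ← List.prod_append, ← List.map_append,
    ← List.prod_append, ← List.map_append] at h
  have := congrArg (fun e : Equiv.Perm _ => (e ⟨π, hπ⟩).1) h
  simp only [coe_prod_togglePerm, applyB_append] at this
  exact this

end TogglePerm

/-- Let `P` be a graded poset of rank `r` and `κ > 0`.  Then
`∇ ∘ Row^B_F = Row^B_A ∘ ∇` and `∇ ∘ Rvac^B_F = Rvac^B_A ∘ ∇` as maps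
`F^B_κ(P) → A^B_κ(P)`.  Consequently `Rvac^B_A` is an involution on `A^B_κ(P)` and
`Rvac^B_A ∘ Row^B_A = (Row^B_A)⁻¹ ∘ Rvac^B_A` (expressed in the equivalent form
`Row^B_A ∘ Rvac^B_A ∘ Row^B_A = Rvac^B_A`). -/
theorem stmt4 {P : Type} [Fintype P] [PartialOrder P] [Nonempty P]
    (r : ℕ) (rk : P → ℕ)
    (hmin : ∀ x : P, IsMin x → rk x = 0)
    (hcov : ∀ x y : P, x ⋖ y → rk y = rk x + 1)
    (hmax : ∀ x : P, IsMax x → rk x = r)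
    (κ : ℝ) (hκ : 0 < κ) :
    (∀ π : Phat P → ℝ, (∀ x, 0 < π x) → π ⊥ = 1 → π (topHat P) = κ →
      downT (RowB rk r π) = RowAB κ rk r (downT π) ∧
      downT (RvacB rk r π) = RvacAB κ rk r (downT π)) ∧
    (∀ σ : P → ℝ, (∀ x, 0 < σ x) →
      RvacAB κ rk r (RvacAB κ rk r σ) = σ ∧
      RowAB κ rk r (RvacAB κ rk r (RowAB κ rk r σ)) = RvacAB κ rk r σ) := by
  have hr := rk_le_of_isMax_eq (strictMono_of_covBy_eq_succ hcov) hmax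
  refine ⟨fun π hπ hbot htop => ⟨downT_RowB hcov hr hπ hbot htop,
    downT_RvacB hcov hr hπ hbot htop⟩, fun σ hσ => ?_⟩
  obtain ⟨π, hπ, hbot, htop, rfl⟩ := exists_downT_eq hκ hσ
  have hRow : RowAB κ rk r (downT π) = downT (RowB rk r π) :=
    (downT_RowB hcov hr hπ hbot htop).symm
  have hRvac (w : List ℕ) : RvacAB κ rk r (downT (applyB rk w π)) =
      downT (RvacB rk r (applyB rk w π)) :=
    (downT_RvacB hcov hr (applyB_pos rk w hπ) ((applyB_bot _ _ _).trans hbot)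
      ((applyB_topHat _ _ _).trans htop)).symm
  have hRow' (w : List ℕ) : RowAB κ rk r (downT (applyB rk w π)) =
      downT (RowB rk r (applyB rk w π)) :=
    (downT_RowB hcov hr (applyB_pos rk w hπ) ((applyB_bot _ _ _).trans hbot)
      ((applyB_topHat _ _ _).trans htop)).symm
  have hRvacRow : RvacB rk r (RowB rk r π) = applyB rk (rvacWordB r ++ rowWordB r) π :=
    (applyB_append rk _ _ π).symm
  constructor
  · rw [← downT_RvacB hcov hr hπ hbot htop, RvacB, hRvac, ← RvacB, RvacB_RvacB hcov r hπ]
  · rw [hRow, RowB, hRvac, ← RowB, hRvacRow, hRow', ← hRvacRow, RowB_RvacB_RowB hcov r hπ,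
      downT_RvacB hcov hr hπ hbot htop]
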